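/- arXiv:2107.11076 — 6 statements merged into one kernel-verified Lean document; each statement's English description precedes it below -/
import Mathlib

section
/- The sublinear expectation of |ξ| is finite and satisfies the explicit bound: sup_{k∈K} ∫_ℝ |z| dP_k(z) ≤ 1 + sup_{k∈K} { (k₋+k₊)/(α(α−1)) + |∫_1^∞ β_{2,k}(z)·z^{−α} dz| + |∫_1^∞ β_{1,k}(−z)·z^{−α} dz| }; in particular, under (A2) this supremum is at most 1 + 2λ₂/(α(α−1)) + 2M < ∞. -/
open MeasureTheory Set Filter

/-- The tail function of a nonnegative integrable function is integrable on `(0, ∞)`. -/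
theorem integrableOn_measureReal_le {Ω : Type*} [MeasurableSpace Ω] {μ : Measure Ω}
    [IsFiniteMeasure μ] {f : Ω → ℝ} (hf : Integrable f μ) (hf0 : 0 ≤ᵐ[μ] f) :
    IntegrableOn (fun t : ℝ => μ.real {a | t ≤ f a}) (Ioi 0) := by
  have hanti : Antitone fun t : ℝ => μ {a | t ≤ f a} := fun s t hst =>
    measure_mono fun a (ha : t ≤ f a) => hst.trans ha
  refine integrable_toReal_of_lintegral_ne_top hanti.measurable.aemeasurable ?_
  rw [← lintegral_eq_lintegral_meas_le μ hf0 hf.aemeasurable]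
  exact hf.lintegral_lt_top.ne

section Tails

variable {μ : Measure ℝ} [IsProbabilityMeasure μ]

theorem integrableOn_measureReal_Ioi (h : Integrable (fun z : ℝ => z) μ) :
    IntegrableOn (fun t : ℝ => μ.real (Ioi t)) (Ioi 1) := by
  have hanti : Antitone fun t : ℝ => μ.real (Ioi t) := fun s t hst =>
    measureReal_mono (Ioi_subset_Ioi hst)
  refine Integrable.mono' ((integrableOn_measureReal_le h.abs
    (Eventually.of_forall fun z => abs_nonneg z)).mono_set (Ioi_subset_Ioi zero_le_one))
    hanti.measurable.aestronglyMeasurable (Eventually.of_forall fun t => ?_)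
  rw [Real.norm_of_nonneg measureReal_nonneg]
  exact measureReal_mono fun z (hz : t < z) => hz.le.trans (le_abs_self z)

theorem integrableOn_measureReal_Iic_neg (h : Integrable (fun z : ℝ => z) μ) :
    IntegrableOn (fun t : ℝ => μ.real (Iic (-t))) (Ioi 1) := by
  have hanti : Antitone fun t : ℝ => μ.real (Iic (-t)) := fun s t hst =>
    measureReal_mono (Iic_subset_Iic.2 (neg_le_neg hst))
  refine Integrable.mono' ((integrableOn_measureReal_le h.abs
    (Eventually.of_forall fun z => abs_nonneg z)).mono_set (Ioi_subset_Ioi zero_le_one))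
    hanti.measurable.aestronglyMeasurable (Eventually.of_forall fun t => ?_)
  rw [Real.norm_of_nonneg measureReal_nonneg]
  exact measureReal_mono fun z (hz : z ≤ -t) => (le_neg.2 hz).trans (neg_le_abs z)

theorem integral_abs_le_one_add_tails (h : Integrable (fun z : ℝ => z) μ) :
    ∫ z, |z| ∂μ ≤ 1 + ((∫ t in Ioi (1 : ℝ), μ.real (Ioi t))
      + ∫ t in Ioi (1 : ℝ), μ.real (Iic (-t))) := by
  have h0 : 0 ≤ᵐ[μ] fun z : ℝ => |z| := Eventually.of_forall fun z => abs_nonneg z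
  have hG := integrableOn_measureReal_le h.abs h0
  have hG1 := hG.mono_set (Ioi_subset_Ioi (zero_le_one' ℝ))
  have hG0 := hG.mono_set (Ioc_subset_Ioi_self : Ioc (0 : ℝ) 1 ⊆ Ioi 0)
  rw [h.abs.integral_eq_integral_meas_le h0, ← Ioc_union_Ioi_eq_Ioi (zero_le_one' ℝ),
    setIntegral_union (Ioc_disjoint_Ioi le_rfl) measurableSet_Ioi hG0 hG1]
  refine add_le_add ?_ ?_
  · refine (setIntegral_mono (g := fun _ => (1 : ℝ)) hG0 (by simp)
      fun t => measureReal_le_one).trans ?_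
    simp
  · rw [← integral_add (integrableOn_measureReal_Ioi h) (integrableOn_measureReal_Iic_neg h)]
    refine integral_mono_ae hG1 ((integrableOn_measureReal_Ioi h).add
      (integrableOn_measureReal_Iic_neg h)) ?_
    filter_upwards [ae_restrict_of_ae (meas_le_ae_eq_meas_lt μ volume fun z : ℝ => |z|)] with t ht
    rw [measureReal_def, ht]
    refine (measureReal_mono ?_).trans (measureReal_union_le (Ioi t) (Iic (-t)))
    intro z hz
    have hz' : t < z ∨ t < -z := lt_abs.1 hz
    exact hz'.imp id fun hneg => (lt_neg.1 hneg).le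

end Tails

theorem setIntegral_tail_eq {α c : ℝ} (hα : 1 < α) {b h : ℝ → ℝ}
    (hh : IntegrableOn h (Ioi 1))
    (heq : ∀ t > (1 : ℝ), h t = (c / α + b t) * t ^ (-α)) :
    ∫ t in Ioi (1 : ℝ), h t = c / (α * (α - 1)) + ∫ t in Ioi (1 : ℝ), b t * t ^ (-α) := by
  have hα' : -α < -1 := neg_lt_neg hα
  have hpow := (integrableOn_Ioi_rpow_of_lt hα' one_pos).const_mul (c / α)
  have hb : ∫ t in Ioi (1 : ℝ), b t * t ^ (-α)
      = ∫ t in Ioi (1 : ℝ), (h t - c / α * t ^ (-α)) :=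
    setIntegral_congr_fun measurableSet_Ioi fun t ht => by
      simp only [heq t ht]
      ring
  rw [hb, integral_sub hh hpow, integral_const_mul, integral_Ioi_rpow_of_lt hα' one_pos,
    Real.one_rpow]
  have h1 : α - 1 ≠ 0 := (sub_pos.2 hα).ne'
  have h2 : -α + 1 ≠ 0 := by
    contrapose! h1
    linarith
  have h3 : α ≠ 0 := (one_pos.trans hα).ne'
  have h4 : -1 / (-α + 1) = 1 / (α - 1) := by
    rw [div_eq_div_iff h2 h1]
    ring
  rw [h4]
  field_simp
  ring

/-- Finiteness and explicit bound for the sublinear expectation of `|ξ|`. -/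
theorem first_moment_bound
    {α lam1 lam2 : ℝ} (hα1 : 1 < α) (hα2 : α < 2)
    (hlam1 : 0 ≤ lam1) (hlam : lam1 < lam2)
    {K : Type*} [Nonempty K]
    (km kp : K → ℝ)
    (hkm : ∀ k, km k ∈ Set.Ioo lam1 lam2)
    (hkp : ∀ k, kp k ∈ Set.Ioo lam1 lam2)
    (P : K → Measure ℝ)
    (hP : ∀ k, IsProbabilityMeasure (P k))
    (hint : ∀ k, Integrable (fun z : ℝ => z) (P k))
    (hmean : ∀ k, ∫ z, z ∂(P k) = 0)
    (β1 β2 : K → ℝ → ℝ)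
    (hβ1meas : ∀ k, Measurable (β1 k))
    (hβ2meas : ∀ k, Measurable (β2 k))
    (hcdfneg : ∀ k, ∀ z < (0:ℝ), ((P k) (Set.Iic z)).toReal = (km k / α + β1 k z) * |z| ^ (-α))
    (hcdfpos : ∀ k, ∀ z > (0:ℝ), ((P k) (Set.Iic z)).toReal = 1 - (kp k / α + β2 k z) * z ^ (-α))
    (hβ1lim : ∀ k, Tendsto (β1 k) atBot (nhds 0))
    (hβ2lim : ∀ k, Tendsto (β2 k) atTop (nhds 0))
    (M : ℝ) (hM : 0 < M)
    (hA2a : ∀ k, |∫ z in Set.Iio (-1 : ℝ), β1 k z * |z| ^ (-α)| ≤ M)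
    (hA2b : ∀ k, |∫ z in Set.Ioi (1 : ℝ), β2 k z * z ^ (-α)| ≤ M) :
    (⨆ k, ∫ z, |z| ∂(P k)) ≤
        1 + (⨆ k, ((km k + kp k) / (α * (α - 1))
          + |∫ z in Set.Ioi (1 : ℝ), β2 k z * z ^ (-α)|
          + |∫ z in Set.Ioi (1 : ℝ), β1 k (-z) * z ^ (-α)|))
      ∧ (⨆ k, ∫ z, |z| ∂(P k)) ≤ 1 + 2 * lam2 / (α * (α - 1)) + 2 * M := by
  have hreflect : ∀ k, ∫ z in Set.Ioi (1 : ℝ), β1 k (-z) * z ^ (-α)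
      = ∫ z in Set.Iio (-1 : ℝ), β1 k z * |z| ^ (-α) := fun k => by
    rw [← integral_Iic_eq_integral_Iio, ← integral_comp_neg_Ioi]
    refine setIntegral_congr_fun measurableSet_Ioi fun z (hz : 1 < z) => ?_
    simp only [abs_neg, abs_of_pos (one_pos.trans hz)]
  have hpt : ∀ k, ∫ z, |z| ∂(P k) ≤ 1 + ((km k + kp k) / (α * (α - 1))
      + |∫ z in Set.Ioi (1 : ℝ), β2 k z * z ^ (-α)|
      + |∫ z in Set.Ioi (1 : ℝ), β1 k (-z) * z ^ (-α)|) := fun k => by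
    have := hP k
    have hright := setIntegral_tail_eq (c := kp k) (b := β2 k) hα1
      (integrableOn_measureReal_Ioi (hint k)) fun t ht => by
        rw [← compl_Iic, probReal_compl_eq_one_sub measurableSet_Iic, measureReal_def,
          hcdfpos k t (one_pos.trans ht), sub_sub_cancel]
    have hleft := setIntegral_tail_eq (c := km k) (b := fun t => β1 k (-t)) hα1
      (integrableOn_measureReal_Iic_neg (hint k)) fun t ht => by
        have ht0 : 0 < t := one_pos.trans ht
        rw [measureReal_def, hcdfneg k (-t) (neg_neg_of_pos ht0), abs_neg, abs_of_pos ht0]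
    have hbound := integral_abs_le_one_add_tails (hint k)
    rw [hright, hleft] at hbound
    rw [add_div]
    linarith [le_abs_self (∫ z in Set.Ioi (1 : ℝ), β2 k z * z ^ (-α)),
      le_abs_self (∫ z in Set.Ioi (1 : ℝ), β1 k (-z) * z ^ (-α))]
  have hunif : ∀ k, (km k + kp k) / (α * (α - 1))
      + |∫ z in Set.Ioi (1 : ℝ), β2 k z * z ^ (-α)|
      + |∫ z in Set.Ioi (1 : ℝ), β1 k (-z) * z ^ (-α)|
      ≤ 2 * lam2 / (α * (α - 1)) + 2 * M := fun k => by
    have hden : 0 < α * (α - 1) := mul_pos (one_pos.trans hα1) (sub_pos.2 hα1)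
    have hk : (km k + kp k) / (α * (α - 1)) ≤ 2 * lam2 / (α * (α - 1)) :=
      div_le_div_of_nonneg_right (by linarith [(hkm k).2, (hkp k).2]) hden.le
    have hM1 := hA2a k
    rw [← hreflect k] at hM1
    linarith [hA2b k]
  refine ⟨ciSup_le fun k => (hpt k).trans ?_, ciSup_le fun k => ?_⟩
  · gcongr
    exact le_ciSup (f := fun k => (km k + kp k) / (α * (α - 1))
      + |∫ z in Set.Ioi (1 : ℝ), β2 k z * z ^ (-α)|
      + |∫ z in Set.Ioi (1 : ℝ), β1 k (-z) * z ^ (-α)|) ⟨_, forall_mem_range.2 hunif⟩ k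
  · linarith [hpt k, hunif k]
end

section
/- (Truncated second-moment identity.) For every N > 0 and every k ∈ K, ∫_ℝ z²·1_{|z|≤N} dP_k(z) = N^{2−α} · [ (k₋+k₊)/(2−α) + 2∫_0^1 (β_{1,k}(−zN) + β_{2,k}(zN))·z^{1−α} dz − β_{1,k}(−N) − β_{2,k}(N) ]; consequently sup_{k∈K} ∫_ℝ z²·1_{|z|≤N} dP_k(z) = N^{2−α}·I_{1,N}, where I_{1,N} is the supremum over k ∈ K of the bracketed expression. -/
open MeasureTheory Set Filter

/-- A probability measure whose distribution function is left-continuous at `a` has no atom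
at `a`. -/
lemma measureReal_Iio_eq_Iic_of_tendsto (μ : Measure ℝ) [IsProbabilityMeasure μ] (a : ℝ)
    (h : Tendsto (fun x => μ.real (Iic x)) (nhdsWithin a (Iio a)) (nhds (μ.real (Iic a)))) :
    μ.real (Iio a) = μ.real (Iic a) := by
  have h0 : μ {a} = 0 := by
    have h' : Tendsto (ProbabilityTheory.cdf μ) (nhdsWithin a (Iio a))
        (nhds (ProbabilityTheory.cdf μ a)) := by
      simpa only [← ProbabilityTheory.cdf_eq_real] using h
    rw [← ProbabilityTheory.measure_cdf μ, StieltjesFunction.measure_singleton,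
      leftLim_eq_of_tendsto h', sub_self, ENNReal.ofReal_zero]
  exact measureReal_congr (Iio_ae_eq_Iic' h0)

/-- The truncated second moment of a finite measure in terms of the tail of `|z|`. -/
lemma setIntegral_sq_abs_le_eq_integral_tail (μ : Measure ℝ) [IsFiniteMeasure μ] (N : ℝ)
    (hN : 0 < N) :
    ∫ z in {z : ℝ | |z| ≤ N}, z ^ 2 ∂μ
      = ∫ s in (0 : ℝ)..N, 2 * s * (μ.real {z | s < |z|} - μ.real {z | N < |z|}) := by
  have hS : MeasurableSet {z : ℝ | |z| ≤ N} := measurableSet_le (by fun_prop) (by fun_prop)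
  have hi : Integrable (fun z : ℝ => z ^ 2) (μ.restrict {z : ℝ | |z| ≤ N}) := by
    refine Integrable.of_bound (C := N ^ 2) (by fun_prop) ?_
    filter_upwards [ae_restrict_mem hS] with z hz
    rw [Real.norm_eq_abs, abs_pow]
    exact pow_le_pow_left₀ (abs_nonneg z) hz 2
  rw [hi.integral_eq_integral_meas_lt (ae_of_all _ fun z => sq_nonneg z),
    ← integral_comp_rpow_Ioi _ (two_ne_zero' ℝ), intervalIntegral.integral_of_le hN.le,
    ← integral_indicator measurableSet_Ioi, ← integral_indicator measurableSet_Ioc]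
  congr 1
  ext s
  by_cases hs : 0 < s
  swap
  · rw [indicator_of_notMem (by simpa using hs), indicator_of_notMem (fun h => hs h.1)]
  rw [indicator_of_mem (by simpa using hs)]
  have hset : {z : ℝ | s ^ (2 : ℝ) < z ^ 2} = {z | s < |z|} := by
    ext z
    simp only [mem_ofPred_eq, Real.rpow_two, sq_lt_sq, abs_of_pos hs]
  have hmeas : MeasurableSet {z : ℝ | s < |z|} := measurableSet_lt (by fun_prop) (by fun_prop)
  rw [hset, measureReal_restrict_apply hmeas]
  by_cases hsN : s ≤ N
  · rw [indicator_of_mem (show s ∈ Ioc 0 N from ⟨hs, hsN⟩)]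
    have hdiff : {z : ℝ | s < |z|} ∩ {z | |z| ≤ N} = {z | s < |z|} \ {z | N < |z|} := by
      ext z
      simp
    have hsub : {z : ℝ | N < |z|} ⊆ {z | s < |z|} := fun z hz => hsN.trans_lt hz
    rw [hdiff, measureReal_sdiff hsub (measurableSet_lt (by fun_prop) (by fun_prop))]
    norm_num
  · rw [indicator_of_notMem (fun h => hsN h.2)]
    have hempty : {z : ℝ | s < |z|} ∩ {z | |z| ≤ N} = ∅ := by
      ext z
      simp only [mem_inter_iff, mem_ofPred_eq, mem_empty_iff_false, iff_false, not_and, not_le]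
      exact fun h => (not_le.mp hsN).trans h
    simp [hempty]

/-- The two-sided tail of a probability measure with regularly varying distribution function. -/
lemma measureReal_lt_abs_of_cdf {α a b : ℝ} (μ : Measure ℝ) [IsProbabilityMeasure μ]
    {f g : ℝ → ℝ}
    (hneg : ∀ z < (0 : ℝ), μ.real (Iic z) = (a / α + f z) * |z| ^ (-α))
    (hpos : ∀ z > (0 : ℝ), μ.real (Iic z) = 1 - (b / α + g z) * z ^ (-α))
    (hf : ContinuousOn f (Iic 0)) {s : ℝ} (hs : 0 < s) :
    μ.real {z | s < |z|} = ((a + b) / α + (f (-s) + g s)) * s ^ (-α) := by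
  have hs' : -s < 0 := neg_lt_zero.mpr hs
  have hset : {z : ℝ | s < |z|} = Iio (-s) ∪ Ioi s := by
    ext z
    simp only [mem_ofPred_eq, lt_abs, mem_union, mem_Iio, mem_Ioi]
    constructor <;> rintro (h | h) <;> first | (left; linarith) | (right; linarith)
  have hdisj : Disjoint (Iio (-s)) (Ioi s) := by
    rw [Set.disjoint_left]
    intro z hz hz'
    simp only [mem_Iio, mem_Ioi] at hz hz'
    linarith
  have hcont : ContinuousAt (fun z => (a / α + f z) * |z| ^ (-α)) (-s) :=
    (continuousAt_const.add (hf.continuousAt (Iic_mem_nhds hs'))).mul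
      (continuous_abs.continuousAt.rpow_const (Or.inl (abs_pos.mpr hs'.ne).ne'))
  have hatom : μ.real (Iio (-s)) = μ.real (Iic (-s)) := by
    refine measureReal_Iio_eq_Iic_of_tendsto μ (-s) ?_
    rw [hneg _ hs']
    refine (hcont.tendsto.mono_left nhdsWithin_le_nhds).congr' ?_
    filter_upwards [self_mem_nhdsWithin] with z hz
    exact (hneg z (lt_trans hz hs')).symm
  have hIoi : μ.real (Ioi s) = (b / α + g s) * s ^ (-α) := by
    rw [← compl_Iic, probReal_compl_eq_one_sub measurableSet_Iic, hpos s hs]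
    ring
  rw [hset, measureReal_union hdisj measurableSet_Ioi, hatom, hneg _ hs', hIoi, abs_neg,
    abs_of_pos hs]
  ring

/-- Evaluation of the tail integral for a regularly varying tail. -/
lemma integral_tail_of_rpow {α c N : ℝ} (hα0 : 0 < α) (hα2 : α < 2) (hN : 0 < N) {T h : ℝ → ℝ}
    (hT : ∀ s, 0 < s → T s = (c / α + h s) * s ^ (-α)) (hh : ContinuousOn h (Ici 0)) :
    ∫ s in (0 : ℝ)..N, 2 * s * (T s - T N)
      = N ^ (2 - α) * (c / (2 - α) + 2 * (∫ z in Ioo (0 : ℝ) 1, h (z * N) * z ^ (1 - α)) - h N) := by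
  have hrpow : IntervalIntegrable (fun s : ℝ => s ^ (1 - α)) volume 0 N :=
    intervalIntegral.intervalIntegrable_rpow' (by linarith)
  have hmul : IntervalIntegrable (fun s : ℝ => h s * s ^ (1 - α)) volume 0 N :=
    hrpow.continuousOn_mul (hh.mono (by rw [uIcc_of_le hN.le]; exact fun x hx => hx.1))
  have hpow : ∀ s : ℝ, 0 < s → s * s ^ (-α) = s ^ (1 - α) := fun s hs => by
    rw [sub_eq_add_neg, Real.rpow_add hs, Real.rpow_one]
  have hsplit : ∫ s in (0 : ℝ)..N, 2 * s * (T s - T N)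
      = ∫ s in (0 : ℝ)..N,
        ((2 * c / α) * s ^ (1 - α) + 2 * (h s * s ^ (1 - α)) - (2 * T N) * s) := by
    refine intervalIntegral.integral_congr_ae (ae_of_all _ fun s hs => ?_)
    rw [uIoc_of_le hN.le] at hs
    rw [hT s hs.1, ← hpow s hs.1]
    ring
  have hscale : ∫ s in (0 : ℝ)..N, h s * s ^ (1 - α)
      = N ^ (2 - α) * ∫ z in Ioo (0 : ℝ) 1, h (z * N) * z ^ (1 - α) := by
    have hsub := intervalIntegral.mul_integral_comp_mul_right (a := 0) (b := 1)
      (f := fun s => h s * s ^ (1 - α)) N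
    rw [zero_mul, one_mul] at hsub
    rw [← hsub, ← integral_Ioc_eq_integral_Ioo, ← intervalIntegral.integral_of_le zero_le_one,
      ← intervalIntegral.integral_const_mul, ← intervalIntegral.integral_const_mul]
    refine intervalIntegral.integral_congr fun z hz => ?_
    rw [uIcc_of_le zero_le_one] at hz
    rw [Real.mul_rpow hz.1 hN.le, show (2 : ℝ) - α = 1 + (1 - α) by ring, Real.rpow_add hN,
      Real.rpow_one]
    ring
  have hTN : T N * N ^ 2 = (c / α + h N) * N ^ (2 - α) := by
    rw [hT N hN, sub_eq_add_neg, Real.rpow_add hN, Real.rpow_two]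
    ring
  rw [hsplit, intervalIntegral.integral_sub
      ((hrpow.const_mul _).add (hmul.const_mul _))
      (intervalIntegral.intervalIntegrable_id.const_mul _),
    intervalIntegral.integral_add (hrpow.const_mul _) (hmul.const_mul _),
    intervalIntegral.integral_const_mul, intervalIntegral.integral_const_mul,
    intervalIntegral.integral_const_mul, hscale, integral_id,
    integral_rpow (Or.inl (by linarith)), show 1 - α + 1 = 2 - α by ring,
    Real.zero_rpow (by linarith),
    show 2 * T N * ((N ^ 2 - 0 ^ 2) / 2) = T N * N ^ 2 by ring, hTN]
  have : 2 - α ≠ 0 := by linarith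
  generalize ∫ z in Ioo (0 : ℝ) 1, h (z * N) * z ^ (1 - α) = J
  field_simp
  ring

/-- truncated second-moment identity (Lemma 4.2 of the paper). -/
theorem truncated_second_moment
    {α lam1 lam2 : ℝ} (hα1 : 1 < α) (hα2 : α < 2)
    (hlam1 : 0 ≤ lam1) (hlam : lam1 < lam2)
    {K : Type*} [Nonempty K]
    (km kp : K → ℝ)
    (hkm : ∀ k, km k ∈ Set.Ioo lam1 lam2)
    (hkp : ∀ k, kp k ∈ Set.Ioo lam1 lam2)
    (P : K → Measure ℝ)
    (hP : ∀ k, IsProbabilityMeasure (P k))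
    (hint : ∀ k, Integrable (fun z : ℝ => z) (P k))
    (hmean : ∀ k, ∫ z, z ∂(P k) = 0)
    (β1 β2 : K → ℝ → ℝ)
    (hβ1meas : ∀ k, Measurable (β1 k))
    (hβ2meas : ∀ k, Measurable (β2 k))
    (hcdfneg : ∀ k, ∀ z < (0:ℝ), ((P k) (Set.Iic z)).toReal = (km k / α + β1 k z) * |z| ^ (-α))
    (hcdfpos : ∀ k, ∀ z > (0:ℝ), ((P k) (Set.Iic z)).toReal = 1 - (kp k / α + β2 k z) * z ^ (-α))
    (hβ1lim : ∀ k, Tendsto (β1 k) atBot (nhds 0))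
    (hβ2lim : ∀ k, Tendsto (β2 k) atTop (nhds 0))
    (hA1a : ∀ k, ContDiffOn ℝ 1 (β1 k) (Set.Iic 0))
    (hA1b : ∀ k, ContDiffOn ℝ 1 (β2 k) (Set.Ici 0)) :
    ∀ N : ℝ, 0 < N →
      (∀ k, (∫ z in {z : ℝ | |z| ≤ N}, z ^ 2 ∂(P k))
          = N ^ (2 - α) * ((km k + kp k) / (2 - α)
            + 2 * (∫ z in Set.Ioo (0 : ℝ) 1, (β1 k (-(z * N)) + β2 k (z * N)) * z ^ (1 - α))
            - β1 k (-N) - β2 k N))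
      ∧ (⨆ k, ∫ z in {z : ℝ | |z| ≤ N}, z ^ 2 ∂(P k))
          = N ^ (2 - α) * (⨆ k, ((km k + kp k) / (2 - α)
            + 2 * (∫ z in Set.Ioo (0 : ℝ) 1, (β1 k (-(z * N)) + β2 k (z * N)) * z ^ (1 - α))
            - β1 k (-N) - β2 k N)) := by
  intro N hN
  have hmoment : ∀ k, (∫ z in {z : ℝ | |z| ≤ N}, z ^ 2 ∂(P k))
      = N ^ (2 - α) * ((km k + kp k) / (2 - α)
        + 2 * (∫ z in Set.Ioo (0 : ℝ) 1, (β1 k (-(z * N)) + β2 k (z * N)) * z ^ (1 - α))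
        - β1 k (-N) - β2 k N) := by
    intro k
    have := hP k
    have hcont : ContinuousOn (fun s => β1 k (-s) + β2 k s) (Ici 0) := by
      refine ContinuousOn.add ?_ (hA1b k).continuousOn
      exact (hA1a k).continuousOn.comp continuousOn_neg fun s hs =>
        mem_Iic.mpr (neg_nonpos.mpr (mem_Ici.mp hs))
    rw [setIntegral_sq_abs_le_eq_integral_tail (P k) N hN,
      integral_tail_of_rpow (T := fun s => (P k).real {z | s < |z|}) (by linarith) hα2 hN
        (fun s hs => measureReal_lt_abs_of_cdf (P k) (hcdfneg k) (hcdfpos k)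
          (hA1a k).continuousOn hs) hcont, sub_sub _ (β1 k (-N))]
  refine ⟨hmoment, ?_⟩
  rw [Real.mul_iSup_of_nonneg (Real.rpow_nonneg hN.le _)]
  exact iSup_congr hmoment
end

section
/- (Truncation-error identity.) For every N > 0 and every k ∈ K, ∫_ℝ (|z| − N)⁺ dP_k(z) = N^{1−α} · [ (k₋+k₊)/(α(α−1)) + ∫_1^∞ (β_{1,k}(−zN) + β_{2,k}(zN))·z^{−α} dz ]; consequently, writing ξ^N(z) := (z ∧ N) ∨ (−N), the sublinear expectation sup_{k∈K} ∫_ℝ |z − ξ^N(z)| dP_k(z) equals N^{1−α}·I_{2,N}, where I_{2,N} is the supremum over k ∈ K of the bracketed expression. -/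
open MeasureTheory Set Filter

theorem integrableOn_Ioi_mul_rpow_of_tendsto_zero {α N : ℝ} (hα : 1 < α) (hN : 0 < N) {b : ℝ → ℝ}
    (hb : ContinuousOn b (Ioi 0)) (hlim : Tendsto b atTop (nhds 0)) :
    IntegrableOn (fun z => b (z * N) * z ^ (-α)) (Ioi 1) := by
  have hcont : ContinuousOn (fun z => b (z * N) * z ^ (-α)) (Ici 1) := by
    refine ContinuousOn.mul (hb.comp (by fun_prop) ?_) ?_
    · intro z hz
      exact mul_pos (zero_lt_one.trans_le hz) hN
    · exact continuousOn_id.rpow_const fun z hz => Or.inl (zero_lt_one.trans_le hz).ne'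
  refine IntegrableOn.mono_set
    ((hcont.locallyIntegrableOn measurableSet_Ici).integrableOn_of_isBigO_atTop
      (g := fun z : ℝ => z ^ (-α)) ?_ ?_) Ioi_subset_Ici_self
  · have hbdd : (fun z => b (z * N)) =O[atTop] (fun _ => (1 : ℝ)) :=
      (hlim.comp (tendsto_id.atTop_mul_const hN)).isBigO_one ℝ
    simpa using hbdd.mul (Asymptotics.isBigO_refl (fun z : ℝ => z ^ (-α)) atTop)
  · exact ⟨Ioi 1, Ioi_mem_atTop 1, integrableOn_Ioi_rpow_of_lt (by linarith) one_pos⟩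

theorem setIntegral_Ioi_comp_add_right (g : ℝ → ℝ) (a N : ℝ) :
    ∫ t in Ioi a, g (t + N) = ∫ s in Ioi (a + N), g s := by
  have h := (measurePreserving_add_right volume N).setIntegral_preimage_emb
    (measurableEmbedding_addRight N) g (Ioi (a + N))
  simpa using h

theorem setIntegral_power_tail {α N c : ℝ} (hα : 1 < α) (hN : 0 < N) {G b : ℝ → ℝ}
    (hb : ContinuousOn b (Ioi 0)) (hlim : Tendsto b atTop (nhds 0))
    (hG : ∀ s > 0, G s = (c / α + b s) * s ^ (-α)) :
    ∫ t in Ioi 0, G (t + N) =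
      N ^ (1 - α) * (c / (α * (α - 1)) + ∫ z in Ioi 1, b (z * N) * z ^ (-α)) := by
  have hscale : ∫ s in Ioi N, G s = N * ∫ z in Ioi 1, G (z * N) := by
    rw [integral_comp_mul_right_Ioi G 1 hN, one_mul, smul_eq_mul, mul_inv_cancel_left₀ hN.ne']
  have htail : ∫ z in Ioi 1, G (z * N) =
      ∫ z in Ioi 1, N ^ (-α) * (c / α * z ^ (-α) + b (z * N) * z ^ (-α)) := by
    refine setIntegral_congr_fun measurableSet_Ioi fun z hz => ?_
    have hz0 : 0 < z := zero_lt_one.trans hz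
    simp only [hG _ (mul_pos hz0 hN), Real.mul_rpow hz0.le hN.le]
    ring
  have hpow : N ^ (1 - α) = N * N ^ (-α) := by
    rw [sub_eq_add_neg, Real.rpow_add hN, Real.rpow_one]
  have hα1 : α - 1 ≠ 0 := by linarith
  have hα1' : -α + 1 ≠ 0 := by linarith
  have hα0 : α ≠ 0 := by linarith
  have hmain : c / α * (-1 / (-α + 1)) = c / (α * (α - 1)) := by
    rw [show -α + 1 = -(α - 1) by ring, neg_div_neg_eq]
    field_simp
  rw [setIntegral_Ioi_comp_add_right, zero_add, hscale, htail, integral_const_mul,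
    integral_add ((integrableOn_Ioi_rpow_of_lt (by linarith) one_pos).const_mul _)
      (integrableOn_Ioi_mul_rpow_of_tendsto_zero hα hN hb hlim), integral_const_mul,
    integral_Ioi_rpow_of_lt (by linarith) one_pos, Real.one_rpow, hmain, hpow, mul_assoc]

theorem max_abs_sub_eq_add {N : ℝ} (hN : 0 < N) (z : ℝ) :
    max (|z| - N) 0 = max (z - N) 0 + max (-z - N) 0 := by
  rcases le_total 0 z with h | h
  · rw [abs_of_nonneg h, max_eq_right (a := -z - N) (by linarith), add_zero]
  · rw [abs_of_nonpos h, max_eq_right (a := z - N) (by linarith), zero_add]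

theorem abs_sub_truncation {N : ℝ} (hN : 0 < N) (z : ℝ) :
    |z - max (min z N) (-N)| = max (|z| - N) 0 := by
  grind

theorem integral_max_abs_sub_eq {α N cm cp : ℝ} (hα : 1 < α) (hN : 0 < N)
    (μ : Measure ℝ) [IsProbabilityMeasure μ] (hint : Integrable (fun z : ℝ => z) μ)
    {b₁ b₂ : ℝ → ℝ} (hb₁ : ContinuousOn b₁ (Iio 0)) (hb₂ : ContinuousOn b₂ (Ioi 0))
    (hlim₁ : Tendsto b₁ atBot (nhds 0)) (hlim₂ : Tendsto b₂ atTop (nhds 0))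
    (hneg : ∀ z < 0, μ.real (Iic z) = (cm / α + b₁ z) * |z| ^ (-α))
    (hpos : ∀ z > 0, μ.real (Iic z) = 1 - (cp / α + b₂ z) * z ^ (-α)) :
    ∫ z, max (|z| - N) 0 ∂μ = N ^ (1 - α) * ((cm + cp) / (α * (α - 1))
      + ∫ z in Ioi 1, (b₁ (-(z * N)) + b₂ (z * N)) * z ^ (-α)) := by
  have hb₁' : ContinuousOn (fun z => b₁ (-z)) (Ioi 0) :=
    hb₁.comp continuousOn_neg fun z (hz : 0 < z) => neg_lt_zero.mpr hz
  have hlim₁' : Tendsto (fun z => b₁ (-z)) atTop (nhds 0) :=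
    hlim₁.comp tendsto_neg_atTop_atBot
  have hintp : Integrable (fun z : ℝ => max (z - N) 0) μ :=
    (hint.sub (integrable_const N)).pos_part
  have hintm : Integrable (fun z : ℝ => max (-z - N) 0) μ :=
    (hint.neg.sub (integrable_const N)).pos_part
  have hp : ∫ z, max (z - N) 0 ∂μ =
      N ^ (1 - α) * (cp / (α * (α - 1)) + ∫ z in Ioi 1, b₂ (z * N) * z ^ (-α)) := by
    rw [← setIntegral_power_tail (G := fun s => μ.real (Ioi s)) hα hN hb₂ hlim₂,
      hintp.integral_eq_integral_meas_lt (ae_of_all _ fun z => le_max_right _ _)]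
    · refine setIntegral_congr_fun measurableSet_Ioi fun t (ht : 0 < t) => ?_
      congr 1
      ext z
      simp [lt_sub_iff_add_lt, ht.not_gt]
    · intro s hs
      rw [← compl_Iic, probReal_compl_eq_one_sub measurableSet_Iic, hpos s hs, sub_sub_cancel]
  have hm : ∫ z, max (-z - N) 0 ∂μ =
      N ^ (1 - α) * (cm / (α * (α - 1)) + ∫ z in Ioi 1, b₁ (-(z * N)) * z ^ (-α)) := by
    rw [← setIntegral_power_tail (G := fun s => μ.real (Iic (-s))) (b := fun z => b₁ (-z))
        hα hN hb₁' hlim₁',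
      hintm.integral_eq_integral_meas_le (ae_of_all _ fun z => le_max_right _ _)]
    · refine setIntegral_congr_fun measurableSet_Ioi fun t (ht : 0 < t) => ?_
      congr 1
      ext z
      simp only [mem_ofPred_eq, mem_Iic, le_max_iff, ht.not_ge, or_false]
      constructor <;> intro h <;> linarith
    · intro s hs
      rw [hneg (-s) (neg_lt_zero.mpr hs), abs_neg, abs_of_pos hs]
  simp_rw [max_abs_sub_eq_add hN, add_mul]
  rw [integral_add hintp hintm, hp, hm,
    integral_add (integrableOn_Ioi_mul_rpow_of_tendsto_zero hα hN hb₁' hlim₁')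
      (integrableOn_Ioi_mul_rpow_of_tendsto_zero hα hN hb₂ hlim₂)]
  ring

/-- truncation-error identity (Lemma 4.3 of the paper). -/
theorem truncation_error_identity
    {α lam1 lam2 : ℝ} (hα1 : 1 < α) (hα2 : α < 2)
    (hlam1 : 0 ≤ lam1) (hlam : lam1 < lam2)
    {K : Type*} [Nonempty K]
    (km kp : K → ℝ)
    (hkm : ∀ k, km k ∈ Set.Ioo lam1 lam2)
    (hkp : ∀ k, kp k ∈ Set.Ioo lam1 lam2)
    (P : K → Measure ℝ)
    (hP : ∀ k, IsProbabilityMeasure (P k))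
    (hint : ∀ k, Integrable (fun z : ℝ => z) (P k))
    (hmean : ∀ k, ∫ z, z ∂(P k) = 0)
    (β1 β2 : K → ℝ → ℝ)
    (hβ1meas : ∀ k, Measurable (β1 k))
    (hβ2meas : ∀ k, Measurable (β2 k))
    (hcdfneg : ∀ k, ∀ z < (0:ℝ), ((P k) (Set.Iic z)).toReal = (km k / α + β1 k z) * |z| ^ (-α))
    (hcdfpos : ∀ k, ∀ z > (0:ℝ), ((P k) (Set.Iic z)).toReal = 1 - (kp k / α + β2 k z) * z ^ (-α))
    (hβ1lim : ∀ k, Tendsto (β1 k) atBot (nhds 0))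
    (hβ2lim : ∀ k, Tendsto (β2 k) atTop (nhds 0))
    (hA1a : ∀ k, ContDiffOn ℝ 1 (β1 k) (Set.Iic 0))
    (hA1b : ∀ k, ContDiffOn ℝ 1 (β2 k) (Set.Ici 0)) :
    ∀ N : ℝ, 0 < N →
      (∀ k, (∫ z, max (|z| - N) 0 ∂(P k))
          = N ^ (1 - α) * ((km k + kp k) / (α * (α - 1))
            + (∫ z in Set.Ioi (1 : ℝ), (β1 k (-(z * N)) + β2 k (z * N)) * z ^ (-α))))
      ∧ (⨆ k, ∫ z, |z - max (min z N) (-N)| ∂(P k))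
          = N ^ (1 - α) * (⨆ k, ((km k + kp k) / (α * (α - 1))
            + (∫ z in Set.Ioi (1 : ℝ), (β1 k (-(z * N)) + β2 k (z * N)) * z ^ (-α)))) := by
  intro N hN
  have key := fun k => haveI := hP k
    integral_max_abs_sub_eq hα1 hN (P k) (hint k)
      ((hA1a k).continuousOn.mono Iio_subset_Iic_self)
      ((hA1b k).continuousOn.mono Ioi_subset_Ici_self)
      (hβ1lim k) (hβ2lim k) (hcdfneg k) (hcdfpos k)
  refine ⟨key, ?_⟩
  rw [Real.mul_iSup_of_nonneg (Real.rpow_nonneg hN.le _)]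
  refine iSup_congr fun k => ?_
  simp_rw [abs_sub_truncation hN]
  exact key k
end

section
/- (Example with polynomial tail, case β > 2.) Let α ∈ (1,2), β > 2, a ≥ 0, c ≥ 0, and let β̃ : [0,∞) → ℝ be measurable with β̃(z) = a·z^{α−β} for all z ≥ 1 and |β̃(z)| ≤ c for all z ∈ (0,1). Then for every Δ ∈ (0,1), with B_Δ := Δ^{1/α}, one has ∫_0^1 |β̃(B_Δ^{−1} z)|·z^{1−α} dz ≤ (c/(2−α) + 2a/(β−2))·Δ^{(2−α)/α}. -/
open MeasureTheory Set Filter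

/-- A function on `(0, 1)` bounded by `c * z ^ p` below `B` and by `k * z ^ q` from `B` on has
integral at most the sum of the integrals of these powers over `(0, B)` and `(B, ∞)`. -/
lemma setIntegral_Ioo_le_of_le_rpow {f : ℝ → ℝ} {B c k p q : ℝ} (hB : 0 < B)
    (hc : 0 ≤ c) (hk : 0 ≤ k) (hp : -1 < p) (hq : q < -1)
    (hf : ∀ z ∈ Ioo (0 : ℝ) 1, 0 ≤ f z)
    (hsmall : ∀ z ∈ Ioo (0 : ℝ) B, f z ≤ c * z ^ p)
    (hlarge : ∀ z ∈ Ici B, f z ≤ k * z ^ q) :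
    ∫ z in Ioo (0 : ℝ) 1, f z
      ≤ c * (B ^ (p + 1) / (p + 1)) + k * (-B ^ (q + 1) / (q + 1)) := by
  have hint₁ : IntegrableOn (fun z : ℝ => c * z ^ p) (Ioo 0 B) :=
    ((intervalIntegral.integrableOn_Ioo_rpow_iff hB).2 hp).const_mul c
  have hint₂ : IntegrableOn (fun z : ℝ => k * z ^ q) (Ici B) :=
    (integrableOn_Ici_iff_integrableOn_Ioi enorm_ne_top).2
      ((integrableOn_Ioi_rpow_of_lt hq hB).const_mul k)
  have hval₁ : ∫ z in Ioo (0 : ℝ) B, c * z ^ p = c * (B ^ (p + 1) / (p + 1)) := by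
    rw [integral_const_mul, ← integral_Ioc_eq_integral_Ioo,
      ← intervalIntegral.integral_of_le hB.le, integral_rpow (Or.inl hp),
      Real.zero_rpow (by linarith), sub_zero]
  have hval₂ : ∫ z in Ici B, k * z ^ q = k * (-B ^ (q + 1) / (q + 1)) := by
    rw [integral_Ici_eq_integral_Ioi, integral_const_mul, integral_Ioi_rpow_of_lt hq hB]
  rw [← hval₁, ← hval₂, ← integral_indicator measurableSet_Ioo,
    ← integral_indicator measurableSet_Ioo, ← integral_indicator measurableSet_Ici,
    ← integral_add (hint₁.integrable_indicator measurableSet_Ioo)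
      (hint₂.integrable_indicator measurableSet_Ici)]
  refine integral_mono_of_nonneg (Eventually.of_forall fun z => indicator_nonneg hf z)
    ((hint₁.integrable_indicator measurableSet_Ioo).add
      (hint₂.integrable_indicator measurableSet_Ici)) (Eventually.of_forall fun z => ?_)
  have hnn₁ : 0 ≤ (Ioo 0 B).indicator (fun z : ℝ => c * z ^ p) z :=
    indicator_nonneg (fun x hx => mul_nonneg hc (Real.rpow_nonneg hx.1.le _)) z
  have hnn₂ : 0 ≤ (Ici B).indicator (fun z : ℝ => k * z ^ q) z :=
    indicator_nonneg (fun x hx => mul_nonneg hk (Real.rpow_nonneg (hB.le.trans hx) _)) z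
  beta_reduce
  by_cases hz : z ∈ Ioo (0 : ℝ) 1
  · rcases lt_or_ge z B with h | h
    · have hz' : z ∈ Ioo 0 B := ⟨hz.1, h⟩
      have := hsmall z hz'
      rw [indicator_of_mem hz'] at hnn₁ ⊢
      rw [indicator_of_mem hz]
      linarith
    · have := hlarge z h
      rw [indicator_of_mem (mem_Ici.2 h)] at hnn₂ ⊢
      rw [indicator_of_mem hz]
      linarith
  · rw [indicator_of_notMem hz]
    exact add_nonneg hnn₁ hnn₂

/-- example with polynomial tail, case `β > 2`
(Example 3.2 of the paper). -/
theorem example_polynomial_tail_large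
    {α b a c : ℝ} (hα1 : 1 < α) (hα2 : α < 2) (hb : 2 < b)
    (ha : 0 ≤ a) (hc : 0 ≤ c)
    (βt : ℝ → ℝ) (hβmeas : Measurable βt)
    (hβtail : ∀ z : ℝ, 1 ≤ z → βt z = a * z ^ (α - b))
    (hβbd : ∀ z ∈ Set.Ioo (0 : ℝ) 1, |βt z| ≤ c) :
    ∀ Δ ∈ Set.Ioo (0 : ℝ) 1,
      (∫ z in Set.Ioo (0 : ℝ) 1, |βt (z / Δ ^ (1 / α))| * z ^ (1 - α))
        ≤ (c / (2 - α) + 2 * a / (b - 2)) * Δ ^ ((2 - α) / α) := by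
  intro Δ hΔ
  have hpow : Δ ^ ((2 - α) / α) = (Δ ^ (1 / α)) ^ (2 - α) := by
    rw [← Real.rpow_mul hΔ.1.le]
    ring_nf
  rw [hpow]
  have hB : 0 < Δ ^ (1 / α) := Real.rpow_pos_of_pos hΔ.1 _
  generalize Δ ^ (1 / α) = B at hB ⊢
  have hbound := setIntegral_Ioo_le_of_le_rpow
    (f := fun z => |βt (z / B)| * z ^ (1 - α)) (c := c) (k := a * B ^ (b - α))
    (p := 1 - α) (q := 1 - b) hB hc (mul_nonneg ha (Real.rpow_nonneg hB.le _))
    (by linarith) (by linarith)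
    (fun z hz => mul_nonneg (abs_nonneg _) (Real.rpow_nonneg hz.1.le _))
    (fun z hz => mul_le_mul_of_nonneg_right
      (hβbd _ ⟨div_pos hz.1 hB, (div_lt_one hB).2 hz.2⟩) (Real.rpow_nonneg hz.1.le _))
    (fun z hz => by
      have hz0 : 0 < z := hB.trans_le hz
      have hinv : B ^ (b - α) = (B ^ (α - b))⁻¹ := by
        rw [← Real.rpow_neg hB.le, neg_sub]
      have hsplit : z ^ (1 - b) = z ^ (α - b) * z ^ (1 - α) := by
        rw [← Real.rpow_add hz0]
        ring_nf
      simp only [hβtail _ ((one_le_div hB).2 hz)]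
      rw [abs_of_nonneg (mul_nonneg ha (Real.rpow_nonneg (div_pos hz0 hB).le _)),
        Real.div_rpow hz0.le hB.le, hinv, hsplit]
      exact le_of_eq (by ring))
  refine hbound.trans ?_
  have hcomb : B ^ (2 - α) = B ^ (b - α) * B ^ (2 - b) := by
    rw [← Real.rpow_add hB]
    ring_nf
  have hneg : -B ^ (2 - b) / (2 - b) = B ^ (2 - b) / (b - 2) := by
    rw [← neg_sub b 2, neg_div_neg_eq]
  rw [show 1 - α + 1 = 2 - α by ring, show 1 - b + 1 = 2 - b by ring, hneg]
  have hnn : 0 ≤ a / (b - 2) * B ^ (2 - α) :=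
    mul_nonneg (div_nonneg ha (by linarith)) (Real.rpow_nonneg hB.le _)
  calc c * (B ^ (2 - α) / (2 - α)) + a * B ^ (b - α) * (B ^ (2 - b) / (b - 2))
      = c / (2 - α) * B ^ (2 - α) + a / (b - 2) * B ^ (2 - α) := by
        rw [hcomb]
        ring
    _ ≤ (c / (2 - α) + 2 * a / (b - 2)) * B ^ (2 - α) := by
        rw [add_mul, mul_div_assoc, mul_assoc]
        linarith
end

section
/- (Comparison principle for the monotone scheme.) Let T > 0 and Δ ∈ (0,1) with Δ < T. Suppose v̲, v̄ : [0,T]×ℝ → ℝ are bounded continuous and h₁, h₂ : (Δ,T]×ℝ → ℝ are bounded continuous, and that S(Δ, x, v̲(t,x), v̲(t−Δ,·)) ≤ h₁(t,x) and S(Δ, x, v̄(t,x), v̄(t−Δ,·)) ≥ h₂(t,x) for all (t,x) ∈ (Δ,T]×ℝ. Then for every (t,x) ∈ [0,T]×ℝ: v̲(t,x) − v̄(t,x) ≤ sup_{(s,y)∈[0,Δ]×ℝ} (v̲(s,y) − v̄(s,y))⁺ + t·sup_{(s,y)∈(Δ,T]×ℝ} (h₁(s,y) − h₂(s,y))⁺.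 -/
open MeasureTheory Set Filter

/-- The monotone scheme operator
`S(Δ,x,p,v) = (p - sup_k ∫ v(x + Δ^{1/α} z) dP_k(z)) / Δ`. -/
noncomputable def schemeS {K : Type*} (P : K → MeasureTheory.Measure ℝ)
    (α Δ x p : ℝ) (v : ℝ → ℝ) : ℝ :=
  (p - ⨆ k, ∫ z, v (x + Δ ^ (1 / α) * z) ∂(P k)) / Δ

/-- A bounded family of bounded functions is dominated by its iterated supremum of positive parts. -/
theorem le_iSup_iSup_max_zero {ι κ : Type*} {f : ι → κ → ℝ} {C : ℝ}
    (hf : ∀ i j, f i j ≤ C) (i : ι) (j : κ) :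
    f i j ≤ ⨆ i, ⨆ j, max (f i j) 0 := by
  have hle : ∀ i j, max (f i j) 0 ≤ max C 0 := fun i j => max_le_max_right 0 (hf i j)
  have hinner : BddAbove (range fun j => max (f i j) 0) :=
    ⟨max C 0, forall_mem_range.2 (hle i)⟩
  have houter : BddAbove (range fun i => ⨆ j, max (f i j) 0) :=
    ⟨max C 0, forall_mem_range.2 fun i => Real.iSup_le (hle i) (le_max_right _ _)⟩
  exact (le_max_left _ 0).trans ((le_ciSup hinner j).trans (le_ciSup houter i))

/-- The supremum of expectations of a bounded continuous function is monotone, up to a constant. -/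
theorem iSup_integral_le_iSup_integral_add {K : Type*} [Nonempty K] (P : K → Measure ℝ)
    (hP : ∀ k, IsProbabilityMeasure (P k)) {f g : ℝ → ℝ} {C D B : ℝ}
    (hf : Continuous f) (hfC : ∀ z, |f z| ≤ C) (hg : Continuous g) (hgD : ∀ z, |g z| ≤ D)
    (hfg : ∀ z, f z ≤ g z + B) :
    ⨆ k, ∫ z, f z ∂(P k) ≤ (⨆ k, ∫ z, g z ∂(P k)) + B := by
  have integrable_of_bdd : ∀ {u : ℝ → ℝ} {E : ℝ}, Continuous u → (∀ z, |u z| ≤ E) →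
      ∀ k, Integrable u (P k) := fun hu hE k =>
    Integrable.of_bound hu.aestronglyMeasurable _ (Eventually.of_forall hE)
  have hgbdd : BddAbove (range fun k => ∫ z, g z ∂(P k)) := by
    refine ⟨D, forall_mem_range.2 fun k => ?_⟩
    calc ∫ z, g z ∂(P k) ≤ ∫ _, D ∂(P k) :=
          integral_mono (integrable_of_bdd hg hgD k) (integrable_const D)
            fun z => (le_abs_self _).trans (hgD z)
      _ = D := by simp
  refine ciSup_le fun k => ?_
  calc ∫ z, f z ∂(P k) ≤ ∫ z, (g z + B) ∂(P k) :=
        integral_mono (integrable_of_bdd hf hfC k)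
          ((integrable_of_bdd hg hgD k).add (integrable_const B)) hfg
    _ = (∫ z, g z ∂(P k)) + B := by
        rw [integral_add (integrable_of_bdd hg hgD k) (integrable_const B)]
        simp
    _ ≤ (⨆ k, ∫ z, g z ∂(P k)) + B := by
        gcongr
        exact le_ciSup hgbdd k

/-- comparison principle for the monotone scheme (Lemma 5.2 of the paper). -/
theorem scheme_comparison
    {α lam1 lam2 : ℝ} (hα1 : 1 < α) (hα2 : α < 2)
    (hlam1 : 0 ≤ lam1) (hlam : lam1 < lam2)
    {K : Type*} [Nonempty K]
    (km kp : K → ℝ)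
    (hkm : ∀ k, km k ∈ Set.Ioo lam1 lam2)
    (hkp : ∀ k, kp k ∈ Set.Ioo lam1 lam2)
    (P : K → Measure ℝ)
    (hP : ∀ k, IsProbabilityMeasure (P k))
    (hint : ∀ k, Integrable (fun z : ℝ => z) (P k))
    (hmean : ∀ k, ∫ z, z ∂(P k) = 0)
    (β1 β2 : K → ℝ → ℝ)
    (hβ1meas : ∀ k, Measurable (β1 k))
    (hβ2meas : ∀ k, Measurable (β2 k))
    (hcdfneg : ∀ k, ∀ z < (0:ℝ), ((P k) (Set.Iic z)).toReal = (km k / α + β1 k z) * |z| ^ (-α))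
    (hcdfpos : ∀ k, ∀ z > (0:ℝ), ((P k) (Set.Iic z)).toReal = 1 - (kp k / α + β2 k z) * z ^ (-α))
    (hβ1lim : ∀ k, Tendsto (β1 k) atBot (nhds 0))
    (hβ2lim : ∀ k, Tendsto (β2 k) atTop (nhds 0))
    (T Δ : ℝ) (hT : 0 < T) (hΔ : Δ ∈ Set.Ioo (0 : ℝ) 1) (hΔT : Δ < T)
    (vlow vup : ℝ → ℝ → ℝ)
    (hvlowc : Continuous (fun q : ℝ × ℝ => vlow q.1 q.2))
    (hvlowb : ∃ C, ∀ t x : ℝ, |vlow t x| ≤ C)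
    (hvupc : Continuous (fun q : ℝ × ℝ => vup q.1 q.2))
    (hvupb : ∃ C, ∀ t x : ℝ, |vup t x| ≤ C)
    (h₁ h₂ : ℝ → ℝ → ℝ)
    (hh₁c : ContinuousOn (fun q : ℝ × ℝ => h₁ q.1 q.2) (Set.Ioc Δ T ×ˢ Set.univ))
    (hh₁b : ∃ C, ∀ t ∈ Set.Ioc Δ T, ∀ x : ℝ, |h₁ t x| ≤ C)
    (hh₂c : ContinuousOn (fun q : ℝ × ℝ => h₂ q.1 q.2) (Set.Ioc Δ T ×ˢ Set.univ))
    (hh₂b : ∃ C, ∀ t ∈ Set.Ioc Δ T, ∀ x : ℝ, |h₂ t x| ≤ C)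
    (hsub : ∀ t ∈ Set.Ioc Δ T, ∀ x : ℝ,
      schemeS P α Δ x (vlow t x) (vlow (t - Δ)) ≤ h₁ t x)
    (hsup : ∀ t ∈ Set.Ioc Δ T, ∀ x : ℝ,
      schemeS P α Δ x (vup t x) (vup (t - Δ)) ≥ h₂ t x) :
    ∀ t ∈ Set.Icc (0 : ℝ) T, ∀ x : ℝ,
      vlow t x - vup t x
        ≤ (⨆ s : Set.Icc (0 : ℝ) Δ, ⨆ y : ℝ, max (vlow s.1 y - vup s.1 y) 0)
          + t * ⨆ s : Set.Ioc Δ T, ⨆ y : ℝ, max (h₁ s.1 y - h₂ s.1 y) 0 := by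
  obtain ⟨C, hC⟩ := hvlowb
  obtain ⟨D, hD⟩ := hvupb
  obtain ⟨C₁, hC₁⟩ := hh₁b
  obtain ⟨C₂, hC₂⟩ := hh₂b
  have hΔ0 : 0 < Δ := hΔ.1
  have hA : ∀ s ∈ Set.Icc (0 : ℝ) Δ, ∀ y, vlow s y - vup s y
      ≤ ⨆ s : Set.Icc (0 : ℝ) Δ, ⨆ y : ℝ, max (vlow s.1 y - vup s.1 y) 0 := fun s hs y =>
    le_iSup_iSup_max_zero (f := fun (s : Set.Icc (0 : ℝ) Δ) y => vlow s.1 y - vup s.1 y)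
      (C := C + D)
      (fun s y => by linarith [(abs_le.1 (hC s.1 y)).2, (abs_le.1 (hD s.1 y)).1]) ⟨s, hs⟩ y
  have hM : ∀ s ∈ Set.Ioc Δ T, ∀ y, h₁ s y - h₂ s y
      ≤ ⨆ s : Set.Ioc Δ T, ⨆ y : ℝ, max (h₁ s.1 y - h₂ s.1 y) 0 := fun s hs y =>
    le_iSup_iSup_max_zero (f := fun (s : Set.Ioc Δ T) y => h₁ s.1 y - h₂ s.1 y)
      (C := C₁ + C₂)
      (fun s y => by
        linarith [(abs_le.1 (hC₁ s.1 s.2 y)).2, (abs_le.1 (hC₂ s.1 s.2 y)).1]) ⟨s, hs⟩ y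
  have hM0 : 0 ≤ ⨆ s : Set.Ioc Δ T, ⨆ y : ℝ, max (h₁ s.1 y - h₂ s.1 y) 0 :=
    Real.iSup_nonneg fun s => Real.iSup_nonneg fun y => le_max_right _ _
  generalize (⨆ s : Set.Icc (0 : ℝ) Δ, ⨆ y : ℝ, max (vlow s.1 y - vup s.1 y) 0) = A at hA ⊢
  generalize (⨆ s : Set.Ioc Δ T, ⨆ y : ℝ, max (h₁ s.1 y - h₂ s.1 y) 0) = M at hM hM0 ⊢
  have base : ∀ t ∈ Set.Icc (0 : ℝ) Δ, ∀ x, vlow t x - vup t x ≤ A + t * M := fun t ht x => by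
    linarith [hA t ht x, mul_nonneg ht.1 hM0]
  have step : ∀ t ∈ Set.Ioc Δ T,
      (∀ x, vlow (t - Δ) x - vup (t - Δ) x ≤ A + (t - Δ) * M) →
      ∀ x, vlow t x - vup t x ≤ A + t * M := by
    intro t ht ih x
    have hsub' := hsub t ht x
    have hsup' := hsup t ht x
    rw [schemeS, div_le_iff₀ hΔ0] at hsub'
    rw [schemeS, ge_iff_le, le_div_iff₀ hΔ0] at hsup'
    have hmono := iSup_integral_le_iSup_integral_add P hP
      (f := fun z => vlow (t - Δ) (x + Δ ^ (1 / α) * z))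
      (g := fun z => vup (t - Δ) (x + Δ ^ (1 / α) * z))
      (B := A + (t - Δ) * M)
      (hvlowc.comp (by fun_prop : Continuous fun z : ℝ => (t - Δ, x + Δ ^ (1 / α) * z)))
      (fun z => hC _ _)
      (hvupc.comp (by fun_prop : Continuous fun z : ℝ => (t - Δ, x + Δ ^ (1 / α) * z)))
      (fun z => hD _ _)
      (fun z => by linarith [ih (x + Δ ^ (1 / α) * z)])
    linarith [mul_le_mul_of_nonneg_right (hM t ht x) hΔ0.le]
  have main : ∀ n : ℕ, ∀ t ∈ Set.Icc (0 : ℝ) T, t ≤ n * Δ →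
      ∀ x, vlow t x - vup t x ≤ A + t * M := by
    intro n
    induction n with
    | zero =>
      intro t ht htn
      exact base t ⟨ht.1, by push_cast at htn; linarith⟩
    | succ n ih =>
      intro t ht htn
      rcases le_or_gt t Δ with h | h
      · exact base t ⟨ht.1, h⟩
      · refine step t ⟨h, ht.2⟩ (ih (t - Δ) ⟨by linarith, by linarith [ht.2]⟩ ?_)
        push_cast at htn
        linarith
  intro t ht
  obtain ⟨n, hn⟩ := exists_nat_ge (t / Δ)
  exact main n t ht ((div_le_iff₀ hΔ0).1 hn)
end

section
/- (Time regularity of the approximation scheme.) Assume (A1) and (A3). Then there exists a constant C' > 0, depending only on α, λ₂, T, the Lipschitz constant C_φ of φ, and the constants C and q appearing in (A3), such that for every Δ ∈ (0,1), all t, s ∈ [0,T] and all x ∈ ℝ: |u_Δ(t,x) − u_Δ(s,x)| ≤ C'·( |t − s|^{1/2} + Δ^{1/2} ), where u_Δ(t,x) := v_{⌊t/Δ⌋}(x). -/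
open MeasureTheory Set Filter

/-- A power-law tail bound for a real measure controls the truncated second moment
`min |h z| (h z)²` of its dilation by `h = Δ ^ (1 / α)`, linearly in `Δ`. -/
lemma integral_min_abs_sq_le_of_tail {α A Δ : ℝ} (hα1 : 1 < α) (hα2 : α < 2) (hA : 0 ≤ A)
    (hΔ : 0 < Δ) {μ : Measure ℝ}
    (htail : ∀ y > 0, μ {z | y < |z|} ≤ ENNReal.ofReal (A * y ^ (-α))) :
    ∫ z, min |Δ ^ (1 / α) * z| ((Δ ^ (1 / α) * z) ^ 2) ∂μ
      ≤ Δ * (A * (1 / (1 - α / 2) + 1 / (α - 1))) := by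
  set h : ℝ := Δ ^ (1 / α) with hh
  have h_pos : 0 < h := Real.rpow_pos_of_pos hΔ _
  have h_pow : h ^ α = Δ := by
    rw [hh, ← Real.rpow_mul hΔ.le, one_div_mul_cancel (by linarith), Real.rpow_one]
  have hG : 0 ≤ 1 / (1 - α / 2) + 1 / (α - 1) := by
    have : 0 < 1 - α / 2 := by linarith
    have : 0 < α - 1 := by linarith
    positivity
  have scaled_tail : ∀ r > 0, μ {z | r < |h * z|} ≤ ENNReal.ofReal (Δ * A * r ^ (-α)) := by
    intro r hr
    have hset : {z : ℝ | r < |h * z|} = {z | r / h < |z|} := by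
      ext z
      simp only [mem_ofPred_eq, abs_mul, abs_of_pos h_pos, div_lt_iff₀ h_pos, mul_comm]
    rw [hset]
    refine (htail _ (by positivity)).trans (ENNReal.ofReal_le_ofReal (le_of_eq ?_))
    rw [Real.div_rpow hr.le h_pos.le, Real.rpow_neg h_pos.le, h_pow]
    field_simp
  have nonneg : ∀ z : ℝ, 0 ≤ min |h * z| ((h * z) ^ 2) := fun z => by positivity
  have meas : Measurable (fun z : ℝ => min |h * z| ((h * z) ^ 2)) := by fun_prop
  have near : ∫⁻ t in Ioc (0 : ℝ) 1, μ {z | t < min |h * z| ((h * z) ^ 2)}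
      ≤ ENNReal.ofReal (Δ * A * (1 / (1 - α / 2))) := by
    have hint : IntegrableOn (fun t : ℝ => t ^ (-α / 2)) (Ioc 0 1) :=
      (intervalIntegrable_iff_integrableOn_Ioc_of_le zero_le_one).1
        (intervalIntegral.intervalIntegrable_rpow' (by linarith))
    calc _ ≤ ∫⁻ t in Ioc (0 : ℝ) 1, ENNReal.ofReal (Δ * A * t ^ (-α / 2)) := by
          refine setLIntegral_mono' measurableSet_Ioc fun t ht => ?_
          have ht0 : 0 < t := ht.1
          have hpow : (Real.sqrt t) ^ (-α) = t ^ (-α / 2) := by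
            rw [Real.sqrt_eq_rpow, ← Real.rpow_mul ht0.le]
            congr 1
            ring
          rw [← hpow]
          refine (measure_mono fun z hz => ?_).trans (scaled_tail _ (Real.sqrt_pos.2 ht0))
          rw [mem_ofPred_eq] at hz ⊢
          rw [← Real.sqrt_sq_eq_abs]
          exact Real.sqrt_lt_sqrt ht0.le (lt_min_iff.1 hz).2
      _ = ENNReal.ofReal (∫ t in Ioc (0 : ℝ) 1, Δ * A * t ^ (-α / 2)) := by
          refine (ofReal_integral_eq_lintegral_ofReal (hint.const_mul _) ?_).symm
          refine (ae_restrict_iff' measurableSet_Ioc).2 (ae_of_all _ fun t ht => ?_)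
          have := Real.rpow_nonneg ht.1.le (-α / 2)
          simp only [Pi.zero_apply]
          positivity
      _ ≤ _ := by
          refine ENNReal.ofReal_le_ofReal (le_of_eq ?_)
          rw [integral_const_mul, ← intervalIntegral.integral_of_le zero_le_one,
            integral_rpow (Or.inl (by linarith)), Real.one_rpow,
            Real.zero_rpow (by linarith)]
          congr 2 <;> ring
  have far : ∫⁻ t in Ioi (1 : ℝ), μ {z | t < min |h * z| ((h * z) ^ 2)}
      ≤ ENNReal.ofReal (Δ * A * (1 / (α - 1))) := by
    have hint : IntegrableOn (fun t : ℝ => t ^ (-α)) (Ioi 1) :=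
      integrableOn_Ioi_rpow_of_lt (by linarith) zero_lt_one
    calc _ ≤ ∫⁻ t in Ioi (1 : ℝ), ENNReal.ofReal (Δ * A * t ^ (-α)) := by
          refine setLIntegral_mono' measurableSet_Ioi fun t ht => ?_
          have ht0 : 0 < t := zero_lt_one.trans ht
          refine (measure_mono fun z hz => ?_).trans (scaled_tail _ ht0)
          rw [mem_ofPred_eq] at hz ⊢
          exact (lt_min_iff.1 hz).1
      _ = ENNReal.ofReal (∫ t in Ioi (1 : ℝ), Δ * A * t ^ (-α)) := by
          refine (ofReal_integral_eq_lintegral_ofReal (hint.const_mul _) ?_).symm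
          refine (ae_restrict_iff' measurableSet_Ioi).2 (ae_of_all _ fun t ht => ?_)
          have := Real.rpow_nonneg (zero_le_one.trans (le_of_lt ht)) (-α)
          simp only [Pi.zero_apply]
          positivity
      _ ≤ _ := by
          refine ENNReal.ofReal_le_ofReal (le_of_eq ?_)
          rw [integral_const_mul, integral_Ioi_rpow_of_lt (by linarith) zero_lt_one,
            Real.one_rpow, neg_div, ← div_neg]
          congr 2
          ring
  rw [integral_eq_lintegral_of_nonneg_ae (ae_of_all _ nonneg) meas.aestronglyMeasurable]
  refine ENNReal.toReal_le_of_le_ofReal (by positivity) ?_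
  rw [lintegral_eq_lintegral_meas_lt μ (ae_of_all _ nonneg) meas.aemeasurable,
    ← Ioc_union_Ioi_eq_Ioi (zero_le_one' ℝ),
    lintegral_union measurableSet_Ioi Ioc_disjoint_Ioi_same]
  refine (add_le_add near far).trans ?_
  have h1 : 0 < 1 - α / 2 := by linarith
  have h2 : 0 < α - 1 := by linarith
  rw [← ENNReal.ofReal_add (by positivity) (by positivity)]
  exact ENNReal.ofReal_le_ofReal (le_of_eq (by ring))

/-- The smooth regularization `√(y² + ε²)` of the absolute value lies below its tangent line plus a
multiple of the truncated quadratic `min |u| u²`. -/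
lemma sqrt_sq_add_sq_le {ε : ℝ} (hε : 0 < ε) (y u : ℝ) :
    Real.sqrt ((y + u) ^ 2 + ε ^ 2) ≤ Real.sqrt (y ^ 2 + ε ^ 2)
      + y / Real.sqrt (y ^ 2 + ε ^ 2) * u + (2 + 1 / (2 * ε)) * min |u| (u ^ 2) := by
  set s := Real.sqrt (y ^ 2 + ε ^ 2) with hs
  have s_sq : s ^ 2 = y ^ 2 + ε ^ 2 := Real.sq_sqrt (by positivity)
  have s_nonneg : 0 ≤ s := Real.sqrt_nonneg _
  have hεs : ε ≤ s := Real.le_sqrt_of_sq_le (by nlinarith)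
  have s_pos : 0 < s := hε.trans_le hεs
  have y_le : |y| ≤ s := Real.abs_le_sqrt (by nlinarith)
  have slope : |y / s * u| ≤ |u| := by
    rw [abs_mul, abs_div, abs_of_pos s_pos]
    exact mul_le_of_le_one_left (abs_nonneg _) ((div_le_one s_pos).2 y_le)
  have hε' : 0 < 1 / (2 * ε) := by positivity
  rcases le_total |u| (u ^ 2) with hu | hu
  · rw [min_eq_left hu]
    have lip : Real.sqrt ((y + u) ^ 2 + ε ^ 2) ≤ s + |u| := by
      refine Real.sqrt_le_iff.2 ⟨by positivity, ?_⟩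
      have : y * u ≤ s * |u| := by
        calc y * u ≤ |y * u| := le_abs_self _
          _ = |y| * |u| := abs_mul _ _
          _ ≤ s * |u| := by gcongr
      nlinarith [sq_abs u]
    have := (abs_le.1 slope).1
    have : 0 ≤ 1 / (2 * ε) * |u| := by positivity
    linarith
  · rw [min_eq_right hu]
    have quad : Real.sqrt ((y + u) ^ 2 + ε ^ 2) ≤ s + y / s * u + u ^ 2 / (2 * s) := by
      have key : s + y / s * u + u ^ 2 / (2 * s)
          = (s ^ 2 + ((y + u) ^ 2 + ε ^ 2)) / (2 * s) := by
        field_simp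
        nlinarith
      rw [key, le_div_iff₀ (by positivity)]
      nlinarith [sq_nonneg (Real.sqrt ((y + u) ^ 2 + ε ^ 2) - s),
        Real.sq_sqrt (show 0 ≤ (y + u) ^ 2 + ε ^ 2 by positivity)]
    have : u ^ 2 / (2 * s) ≤ 1 / (2 * ε) * u ^ 2 := by
      rw [div_eq_mul_one_div, mul_comm]
      gcongr
    nlinarith [sq_nonneg u]

lemma integrable_sqrt_sq_add_sq {μ : Measure ℝ} [IsProbabilityMeasure μ]
    (hμ : Integrable (fun z : ℝ => z) μ) (ε y h : ℝ) :
    Integrable (fun z => Real.sqrt ((y + h * z) ^ 2 + ε ^ 2)) μ := by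
  refine Integrable.mono' (((integrable_const |y|).add (hμ.const_mul h).abs).add
    (integrable_const |ε|)) (by fun_prop) (ae_of_all _ fun z => ?_)
  rw [Real.norm_of_nonneg (Real.sqrt_nonneg _)]
  simp only [Pi.add_apply]
  refine Real.sqrt_le_iff.2 ⟨by positivity, ?_⟩
  have := abs_add_le y (h * z)
  rw [← sq_abs (y + h * z), ← sq_abs ε]
  nlinarith [abs_nonneg (y + h * z), abs_nonneg ε, abs_nonneg y, abs_nonneg (h * z)]

/-- A centred measure with a power-law tail moves the barrier `√(y² + ε²)` up by at most a
multiple of `Δ`. -/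
lemma integral_sqrt_sq_add_sq_le {α A Δ ε : ℝ} (hα1 : 1 < α) (hα2 : α < 2) (hA : 0 ≤ A)
    (hΔ : 0 < Δ) (hε : 0 < ε) {μ : Measure ℝ} [IsProbabilityMeasure μ]
    (hμ : Integrable (fun z : ℝ => z) μ) (hmean : ∫ z, z ∂μ = 0)
    (htail : ∀ y > 0, μ {z | y < |z|} ≤ ENNReal.ofReal (A * y ^ (-α))) (y : ℝ) :
    ∫ z, Real.sqrt ((y + Δ ^ (1 / α) * z) ^ 2 + ε ^ 2) ∂μ ≤ Real.sqrt (y ^ 2 + ε ^ 2)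
      + (2 + 1 / (2 * ε)) * (Δ * (A * (1 / (1 - α / 2) + 1 / (α - 1)))) := by
  set h : ℝ := Δ ^ (1 / α) with hh
  set s := Real.sqrt (y ^ 2 + ε ^ 2)
  have hmin : Integrable (fun z : ℝ => min |h * z| ((h * z) ^ 2)) μ := by
    refine Integrable.mono' (hμ.const_mul h).abs (by fun_prop) (ae_of_all _ fun z => ?_)
    rw [Real.norm_of_nonneg (by positivity)]
    exact min_le_left _ _
  have hlin : Integrable (fun z : ℝ => y / s * (h * z)) μ := (hμ.const_mul h).const_mul _
  calc _ ≤ ∫ z, (s + y / s * (h * z) + (2 + 1 / (2 * ε)) * min |h * z| ((h * z) ^ 2)) ∂μ :=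
        integral_mono (integrable_sqrt_sq_add_sq hμ ε y h)
          (((integrable_const s).add hlin).add (hmin.const_mul _))
          fun z => sqrt_sq_add_sq_le hε y (h * z)
    _ = s + (2 + 1 / (2 * ε)) * ∫ z, min |h * z| ((h * z) ^ 2) ∂μ := by
        have hsum : Integrable (fun z : ℝ => s + y / s * (h * z)) μ :=
          (integrable_const s).add hlin
        rw [integral_add hsum (hmin.const_mul _), integral_add (integrable_const s) hlin, integral_const_mul, integral_const_mul,
          integral_const_mul, hmean]
        simp
    _ ≤ _ := by
        gcongr
        exact integral_min_abs_sq_le_of_tail hα1 hα2 hA hΔ htail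

/-- Tail bound for a law whose distribution function is a perturbed power law on each side. -/
lemma measure_lt_abs_le_of_cdf {α a b lam C : ℝ} (hα : 0 < α) (hlam : 0 ≤ lam)
    (hC : 0 ≤ C) (ha : a ≤ lam) (hb : b ≤ lam) {μ : Measure ℝ} [IsProbabilityMeasure μ]
    {β1 β2 : ℝ → ℝ}
    (hneg : ∀ z < (0 : ℝ), (μ (Iic z)).toReal = (a / α + β1 z) * |z| ^ (-α))
    (hpos : ∀ z > (0 : ℝ), (μ (Iic z)).toReal = 1 - (b / α + β2 z) * z ^ (-α))
    (hβ1 : ∀ y > 1, |β1 (-y)| ≤ C) (hβ2 : ∀ y > 1, |β2 y| ≤ C) :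
    ∀ y > 0, μ {z | y < |z|} ≤ ENNReal.ofReal ((1 + 2 * (lam / α + C)) * y ^ (-α)) := by
  intro y hy
  have hyα : 0 < y ^ (-α) := Real.rpow_pos_of_pos hy _
  have hl : 0 ≤ lam / α := by positivity
  rcases le_or_gt y 1 with hy1 | hy1
  · refine prob_le_one.trans ?_
    rw [← ENNReal.ofReal_one]
    refine ENNReal.ofReal_le_ofReal ?_
    have := Real.one_le_rpow_of_pos_of_le_one_of_nonpos hy hy1 (by linarith : -α ≤ 0)
    nlinarith
  · have left : μ.real (Iic (-y)) ≤ (lam / α + C) * y ^ (-α) := by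
      have e := hneg (-y) (by linarith)
      rw [abs_neg, abs_of_pos hy] at e
      rw [Measure.real, e]
      have := (abs_le.1 (hβ1 y hy1)).2
      gcongr
    have right : μ.real (Iic y)ᶜ ≤ (lam / α + C) * y ^ (-α) := by
      rw [probReal_compl_eq_one_sub measurableSet_Iic, Measure.real, hpos y hy, sub_sub_cancel]
      have := (abs_le.1 (hβ2 y hy1)).2
      gcongr
    have cover : {z | y < |z|} ⊆ Iic (-y) ∪ (Iic y)ᶜ := by
      intro z hz
      rw [mem_ofPred_eq] at hz
      rcases lt_abs.1 hz with hz | hz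
      · exact Or.inr (not_le.2 hz)
      · exact Or.inl (show z ≤ -y by linarith)
    rw [← ofReal_measureReal]
    refine ENNReal.ofReal_le_ofReal ?_
    have := (measureReal_mono (μ := μ) cover).trans (measureReal_union_le _ _)
    nlinarith

lemma abs_ciSup_sub_le {ι : Type*} [Nonempty ι] {f : ι → ℝ} {c D : ℝ}
    (h : ∀ i, |f i - c| ≤ D) : |(⨆ i, f i) - c| ≤ D := by
  have bdd : BddAbove (range f) := ⟨c + D, by
    rintro _ ⟨i, rfl⟩
    linarith [(abs_le.1 (h i)).2]⟩
  have i : ι := Classical.arbitrary ι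
  rw [abs_le]
  constructor
  · linarith [(abs_le.1 (h i)).1, le_ciSup bdd i]
  · have : (⨆ i, f i) ≤ c + D := ciSup_le fun i => by linarith [(abs_le.1 (h i)).2]
    linarith

lemma abs_ciSup_sub_ciSup_le {ι : Type*} [Nonempty ι] {f g : ι → ℝ} {D : ℝ}
    (hf : BddAbove (range f)) (hg : BddAbove (range g)) (h : ∀ i, |f i - g i| ≤ D) :
    |(⨆ i, f i) - ⨆ i, g i| ≤ D := by
  rw [abs_le]
  constructor
  · have : (⨆ i, g i) ≤ (⨆ i, f i) + D :=
      ciSup_le fun i => by linarith [(abs_le.1 (h i)).1, le_ciSup hf i]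
    linarith
  · have : (⨆ i, f i) ≤ (⨆ i, g i) + D :=
      ciSup_le fun i => by linarith [(abs_le.1 (h i)).2, le_ciSup hg i]
    linarith

lemma abs_integral_sub_integral_le {μ : Measure ℝ} {f g G : ℝ → ℝ}
    (hf : Integrable f μ) (hg : Integrable g μ) (hG : Integrable G μ)
    (h : ∀ z, |f z - g z| ≤ G z) : |∫ z, f z ∂μ - ∫ z, g z ∂μ| ≤ ∫ z, G z ∂μ := by
  rw [← integral_sub hf hg]
  rw [← Real.norm_eq_abs]
  refine norm_integral_le_of_norm_le hG (ae_of_all _ fun z => ?_)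
  rw [Real.norm_eq_abs]
  exact h z

lemma abs_integral_le_of_abs_le {μ : Measure ℝ} [IsProbabilityMeasure μ] {f : ℝ → ℝ} {B : ℝ}
    (h : ∀ z, |f z| ≤ B) : |∫ z, f z ∂μ| ≤ B := by
  have bound : ∀ z, ‖f z‖ ≤ B := h
  simpa using norm_integral_le_of_norm_le_const (μ := μ) (ae_of_all _ bound)

lemma integrable_of_bounded_lipschitz {μ : Measure ℝ} [IsFiniteMeasure μ] {f : ℝ → ℝ} {B L : ℝ}
    (hB : ∀ x, |f x| ≤ B) (hL : ∀ x y, |f x - f y| ≤ L * |x - y|) (x h : ℝ) :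
    Integrable (fun z => f (x + h * z)) μ := by
  have cont : Continuous f := (LipschitzWith.of_dist_le' (K := L) hL).continuous
  exact Integrable.of_bound (by fun_prop) B (ae_of_all _ fun z => hB _)

section Scheme

variable {K : Type*} [Nonempty K] {P : K → Measure ℝ} [∀ k, IsProbabilityMeasure (P k)]
  {w : ℕ → ℝ → ℝ} {h L B : ℝ}

/-- The iterates of the sublinear scheme keep the bound and Lipschitz constant of the data. -/
lemma scheme_bounded_lipschitz
    (hw : ∀ j x, w (j + 1) x = ⨆ k, ∫ z, w j (x + h * z) ∂(P k))
    (hB : ∀ x, |w 0 x| ≤ B) (hL : ∀ x y, |w 0 x - w 0 y| ≤ L * |x - y|) (j : ℕ) :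
    (∀ x, |w j x| ≤ B) ∧ ∀ x y, |w j x - w j y| ≤ L * |x - y| := by
  induction j with
  | zero => exact ⟨hB, hL⟩
  | succ j ih =>
    obtain ⟨ihB, ihL⟩ := ih
    have bound : ∀ x k, |∫ z, w j (x + h * z) ∂(P k)| ≤ B := fun x k =>
      abs_integral_le_of_abs_le fun z => ihB (x + h * z)
    have bdd : ∀ x, BddAbove (range fun k => ∫ z, w j (x + h * z) ∂(P k)) := fun x =>
      ⟨B, by rintro _ ⟨k, rfl⟩; exact (abs_le.1 (bound x k)).2⟩
    refine ⟨fun x => ?_, fun x y => ?_⟩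
    · have := abs_ciSup_sub_le (c := 0) fun k => by simpa using bound x k
      rwa [hw, ← sub_zero (iSup _)]
    · rw [hw, hw]
      refine abs_ciSup_sub_ciSup_le (bdd x) (bdd y) fun k => ?_
      simpa using abs_integral_sub_integral_le (integrable_of_bounded_lipschitz ihB ihL x h)
        (integrable_of_bounded_lipschitz ihB ihL y h)
        (integrable_const (μ := P k) (L * |x - y|)) fun z => by
          simpa using ihL (x + h * z) (y + h * z)

/-- The scheme is a contraction in the supremum norm, so a time increment is controlled by the
increment starting at time zero. -/
lemma scheme_increment_le
    (hw : ∀ j x, w (j + 1) x = ⨆ k, ∫ z, w j (x + h * z) ∂(P k))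
    (hB : ∀ x, |w 0 x| ≤ B) (hL : ∀ x y, |w 0 x - w 0 y| ≤ L * |x - y|)
    {n : ℕ} {D : ℝ} (hD : ∀ x, |w n x - w 0 x| ≤ D) (j : ℕ) :
    ∀ x, |w (n + j) x - w j x| ≤ D := by
  have reg := scheme_bounded_lipschitz hw hB hL
  have bdd : ∀ i x, BddAbove (range fun k => ∫ z, w i (x + h * z) ∂(P k)) := fun i x =>
    ⟨B, by
      rintro _ ⟨k, rfl⟩
      exact (abs_le.1 (abs_integral_le_of_abs_le fun z => (reg i).1 (x + h * z))).2⟩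
  induction j with
  | zero => exact hD
  | succ j ih =>
    intro x
    rw [← add_assoc, hw, hw]
    refine abs_ciSup_sub_ciSup_le (bdd _ x) (bdd _ x) fun k => ?_
    simpa using abs_integral_sub_integral_le
      (integrable_of_bounded_lipschitz (reg (n + j)).1 (reg (n + j)).2 x h)
      (integrable_of_bounded_lipschitz (reg j).1 (reg j).2 x h)
      (integrable_const (μ := P k) D) fun z => ih (x + h * z)

/-- Comparison of the scheme with the barrier `√((x - x₀)² + ε²)`, two-sided. -/
lemma scheme_barrier
    (hw : ∀ j x, w (j + 1) x = ⨆ k, ∫ z, w j (x + h * z) ∂(P k))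
    (hB : ∀ x, |w 0 x| ≤ B) (hL : ∀ x y, |w 0 x - w 0 y| ≤ L * |x - y|) (hL0 : 0 ≤ L)
    (hP : ∀ k, Integrable (fun z : ℝ => z) (P k)) {ε D : ℝ}
    (hD : ∀ k y, ∫ z, Real.sqrt ((y + h * z) ^ 2 + ε ^ 2) ∂(P k)
      ≤ Real.sqrt (y ^ 2 + ε ^ 2) + D) (x₀ : ℝ) (j : ℕ) :
    ∀ x, |w j x - w 0 x₀| ≤ L * (Real.sqrt ((x - x₀) ^ 2 + ε ^ 2) + j * D) := by
  induction j with
  | zero =>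
    intro x
    refine (hL x x₀).trans ?_
    gcongr
    rw [Nat.cast_zero, zero_mul, add_zero]
    exact Real.abs_le_sqrt (by nlinarith [sq_nonneg ε])
  | succ j ih =>
    intro x
    obtain ⟨regB, regL⟩ := scheme_bounded_lipschitz hw hB hL j
    rw [hw]
    refine abs_ciSup_sub_le fun k => ?_
    have barrier := integrable_sqrt_sq_add_sq (hP k) ε (x - x₀) h
    have step := abs_integral_sub_integral_le (integrable_of_bounded_lipschitz regB regL x h)
      (integrable_const (μ := P k) (w 0 x₀))
      ((barrier.add (integrable_const (j * D))).const_mul L) fun z => by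
        have := ih (x + h * z)
        rwa [show x + h * z - x₀ = x - x₀ + h * z by ring] at this
    simp only [Pi.add_apply] at step
    rw [integral_const_mul, integral_add barrier (integrable_const _)] at step
    simp only [integral_const, probReal_univ, smul_eq_mul, one_mul] at step
    refine step.trans (mul_le_mul_of_nonneg_left ?_ hL0)
    push_cast
    linarith [hD k (x - x₀)]

end Scheme

lemma floor_div_sub_floor_div_mul_le {Δ t s : ℝ} (hΔ : 0 < Δ) (hs : 0 ≤ s) (hst : s ≤ t) :
    ((⌊t / Δ⌋₊ - ⌊s / Δ⌋₊ : ℕ) : ℝ) * Δ ≤ (t - s) + Δ := by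
  have hle : ⌊s / Δ⌋₊ ≤ ⌊t / Δ⌋₊ := Nat.floor_le_floor (by gcongr)
  rw [Nat.cast_sub hle]
  have h1 : (⌊t / Δ⌋₊ : ℝ) ≤ t / Δ := Nat.floor_le (div_nonneg (hs.trans hst) hΔ.le)
  have h2 : s / Δ < ⌊s / Δ⌋₊ + 1 := Nat.lt_floor_add_one _
  rw [le_div_iff₀ hΔ] at h1
  rw [div_lt_iff₀ hΔ] at h2
  linarith

/-- time regularity of the approximation scheme under (A1) and (A3)
(Theorem 4.1 (ii) of the paper).  The constant `C'` depends only on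
`α, λ₂, T`, the Lipschitz constant `Cφ` of `φ`, and the constants `C, q` of (A3). -/
theorem scheme_time_regularity
    (α lam1 lam2 T Cφ C q : ℝ)
    (hα1 : 1 < α) (hα2 : α < 2)
    (hlam1 : 0 ≤ lam1) (hlam : lam1 < lam2)
    (hT : 0 < T) (hCφ : 0 ≤ Cφ) (hC : 0 < C) (hq : 0 < q) :
    ∃ C' > 0,
      ∀ (K : Type) (_ : Nonempty K) (km kp : K → ℝ),
        (∀ k, km k ∈ Set.Ioo lam1 lam2) →
        (∀ k, kp k ∈ Set.Ioo lam1 lam2) →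
        ∀ (P : K → Measure ℝ),
        (∀ k, IsProbabilityMeasure (P k)) →
        (∀ k, Integrable (fun z : ℝ => z) (P k)) →
        (∀ k, ∫ z, z ∂(P k) = 0) →
        ∀ (β1 β2 : K → ℝ → ℝ),
        (∀ k, Measurable (β1 k)) →
        (∀ k, Measurable (β2 k)) →
        (∀ k, ∀ z < (0:ℝ), ((P k) (Set.Iic z)).toReal = (km k / α + β1 k z) * |z| ^ (-α)) →
        (∀ k, ∀ z > (0:ℝ), ((P k) (Set.Iic z)).toReal = 1 - (kp k / α + β2 k z) * z ^ (-α)) →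
        (∀ k, Tendsto (β1 k) atBot (nhds 0)) →
        (∀ k, Tendsto (β2 k) atTop (nhds 0)) →
        -- (A1)
        (∀ k, ContDiffOn ℝ 1 (β1 k) (Set.Iic 0)) →
        (∀ k, ContDiffOn ℝ 1 (β2 k) (Set.Ici 0)) →
        -- (A3)
        (∀ k, ∀ Δ ∈ Set.Ioo (0:ℝ) 1,
          |β1 k (-(Δ ^ (-(1 / α))))| ≤ C * Δ ^ q ∧
          (∫ z in Set.Ioi (1 : ℝ), |β1 k (-(z / Δ ^ (1 / α)))| * z ^ (-α)) ≤ C * Δ ^ q ∧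
          (∫ z in Set.Ioo (0 : ℝ) 1, |β1 k (-(z / Δ ^ (1 / α)))| * z ^ (1 - α)) ≤ C * Δ ^ q ∧
          |β2 k (Δ ^ (-(1 / α)))| ≤ C * Δ ^ q ∧
          (∫ z in Set.Ioi (1 : ℝ), |β2 k (z / Δ ^ (1 / α))| * z ^ (-α)) ≤ C * Δ ^ q ∧
          (∫ z in Set.Ioo (0 : ℝ) 1, |β2 k (z / Δ ^ (1 / α))| * z ^ (1 - α)) ≤ C * Δ ^ q) →
        ∀ (φ : ℝ → ℝ),
        (∃ B, ∀ x : ℝ, |φ x| ≤ B) →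
        (∀ x y : ℝ, |φ x - φ y| ≤ Cφ * |x - y|) →
        ∀ (v : ℝ → ℕ → ℝ → ℝ),
        (∀ Δ : ℝ, ∀ x : ℝ, v Δ 0 x = φ x) →
        (∀ Δ ∈ Set.Ioo (0:ℝ) 1, ∀ j : ℕ, ∀ x : ℝ,
          v Δ (j + 1) x = ⨆ k, ∫ z, v Δ j (x + Δ ^ (1 / α) * z) ∂(P k)) →
        ∀ Δ ∈ Set.Ioo (0:ℝ) 1, ∀ t ∈ Set.Icc (0:ℝ) T, ∀ s ∈ Set.Icc (0:ℝ) T, ∀ x : ℝ,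
          |v Δ (⌊t / Δ⌋₊) x - v Δ (⌊s / Δ⌋₊) x|
            ≤ C' * (Real.sqrt |t - s| + Real.sqrt Δ) := by
  set A : ℝ := 1 + 2 * (lam2 / α + C) with hA_def
  set G : ℝ := A * (1 / (1 - α / 2) + 1 / (α - 1)) with hG_def
  have hlam2 : 0 ≤ lam2 := hlam1.trans hlam.le
  have hα0 : 0 < α := by linarith
  have hA : 0 ≤ A := by positivity
  have hG : 0 ≤ G := by
    have : 0 < 1 - α / 2 := by linarith
    have : 0 < α - 1 := by linarith
    positivity
  refine ⟨Cφ * (1 + G * (2 * (1 + T) + 1 / 2)) + 1, by positivity, ?_⟩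
  intro K _ km kp hkm hkp P _ hPint hPmean β1 β2 _ _ hF1 hF2 _ _ _ _ hA3 φ hφB hφL v hv0 hv Δ hΔ
  obtain ⟨B, hB⟩ := hφB
  have hΔ0 : 0 < Δ := hΔ.1
  have tail : ∀ k, ∀ y > 0, P k {z | y < |z|} ≤ ENNReal.ofReal (A * y ^ (-α)) := by
    intro k
    have scale : ∀ y > (1 : ℝ), y ^ (-α) ∈ Set.Ioo (0 : ℝ) 1 ∧
        (y ^ (-α)) ^ (-(1 / α)) = y ∧ C * (y ^ (-α)) ^ q ≤ C := by
      intro y hy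
      have hy0 : 0 < y := by linarith
      have hpos : 0 < y ^ (-α) := Real.rpow_pos_of_pos hy0 _
      have hlt : y ^ (-α) < 1 := Real.rpow_lt_one_of_one_lt_of_neg hy (by linarith)
      refine ⟨⟨hpos, hlt⟩, ?_, ?_⟩
      · rw [← Real.rpow_mul hy0.le, neg_mul_neg, mul_one_div_cancel hα0.ne', Real.rpow_one]
      · exact mul_le_of_le_one_right hC.le (Real.rpow_le_one hpos.le hlt.le hq.le)
    refine measure_lt_abs_le_of_cdf hα0 hlam2 hC.le (hkm k).2.le (hkp k).2.le (hF1 k) (hF2 k)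
      (fun y hy => ?_) (fun y hy => ?_)
    · obtain ⟨hmem, hy', hCq⟩ := scale y hy
      have := (hA3 k _ hmem).1
      rw [hy'] at this
      exact this.trans hCq
    · obtain ⟨hmem, hy', hCq⟩ := scale y hy
      have := (hA3 k _ hmem).2.2.2.1
      rw [hy'] at this
      exact this.trans hCq
  have hw : ∀ j x, v Δ (j + 1) x = ⨆ k, ∫ z, v Δ j (x + Δ ^ (1 / α) * z) ∂(P k) := hv Δ hΔ
  have hB' : ∀ x, |v Δ 0 x| ≤ B := fun x => by rw [hv0]; exact hB x
  have hL' : ∀ x y, |v Δ 0 x - v Δ 0 y| ≤ Cφ * |x - y| := fun x y => by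
    rw [hv0, hv0]
    exact hφL x y
  have initial : ∀ n : ℕ, (n : ℝ) * Δ ≤ T → ∀ x, |v Δ n x - v Δ 0 x|
      ≤ Cφ * (1 + G * (2 * (1 + T) + 1 / 2)) * Real.sqrt (n * Δ) := by
    intro n hn x
    rcases Nat.eq_zero_or_pos n with rfl | hn0
    · simp
    set r := Real.sqrt (n * Δ) with hr
    have hr0 : 0 < r := Real.sqrt_pos.2 (by positivity)
    have r_sq : r ^ 2 = n * Δ := Real.sq_sqrt (by positivity)
    have r_le : r ≤ 1 + T := by nlinarith
    have key := scheme_barrier hw hB' hL' hCφ hPint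
      (fun k y => integral_sqrt_sq_add_sq_le hα1 hα2 hA hΔ0 hr0 (hPint k) (hPmean k) (tail k) y)
      x n x
    rw [sub_self, zero_pow two_ne_zero, zero_add, Real.sqrt_sq hr0.le] at key
    refine key.trans ?_
    rw [mul_assoc]
    refine mul_le_mul_of_nonneg_left ?_ hCφ
    have expand : (n : ℝ) * ((2 + 1 / (2 * r)) * (Δ * G)) = G * (2 * r + 1 / 2) * r := by
      calc _ = (n * Δ) * G * (2 + 1 / (2 * r)) := by ring
        _ = r ^ 2 * G * (2 + 1 / (2 * r)) := by rw [r_sq]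
        _ = _ := by field_simp
    rw [← hG_def, expand]
    have : G * (2 * r + 1 / 2) * r ≤ G * (2 * (1 + T) + 1 / 2) * r := by gcongr
    linarith
  have ordered : ∀ t s : ℝ, 0 ≤ s → s ≤ t → t ≤ T → ∀ x,
      |v Δ ⌊t / Δ⌋₊ x - v Δ ⌊s / Δ⌋₊ x|
        ≤ (Cφ * (1 + G * (2 * (1 + T) + 1 / 2)) + 1) * (Real.sqrt |t - s| + Real.sqrt Δ) := by
    intro t s hs hst htT x
    have hle : ⌊s / Δ⌋₊ ≤ ⌊t / Δ⌋₊ := Nat.floor_le_floor (by gcongr)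
    obtain ⟨n, hn⟩ := Nat.exists_eq_add_of_le' hle
    have hn_le : (n : ℝ) * Δ ≤ (t - s) + Δ := by
      have := floor_div_sub_floor_div_mul_le hΔ0 hs hst
      rwa [hn, Nat.add_sub_cancel] at this
    have hnT : (n : ℝ) * Δ ≤ T := by
      have h1 : (n : ℝ) ≤ t / Δ :=
        le_trans (by exact_mod_cast hn ▸ Nat.le_add_right _ _)
          (Nat.floor_le (div_nonneg (hs.trans hst) hΔ0.le))
      rw [le_div_iff₀ hΔ0] at h1
      linarith
    rw [hn]
    refine (scheme_increment_le hw hB' hL' (initial n hnT) _ x).trans ?_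
    have hsqrt : Real.sqrt (n * Δ) ≤ Real.sqrt |t - s| + Real.sqrt Δ := by
      rw [abs_of_nonneg (sub_nonneg.2 hst)]
      refine (Real.sqrt_le_sqrt hn_le).trans (Real.sqrt_le_iff.2 ⟨by positivity, ?_⟩)
      nlinarith [Real.sq_sqrt (sub_nonneg.2 hst), Real.sq_sqrt hΔ0.le,
        mul_nonneg (Real.sqrt_nonneg (t - s)) (Real.sqrt_nonneg Δ)]
    gcongr
    linarith
  intro t ht s hs x
  rcases le_total s t with h | h
  · exact ordered t s hs.1 h ht.2 x
  · rw [abs_sub_comm, abs_sub_comm t s]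
    exact ordered s t ht.1 h hs.2 x
end
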